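/- (Model existence) Every maximal consistent set Φ of modal formulas in S1+SP has a model: there exists an interpretation (M,γ) such that (M,γ) ⊨ φ for every φ ∈ Φ. -/

import Mathlib

/-- Modal formulas over countably many propositional variables x₀, x₁, …. -/
inductive Fm : Type
  | var : ℕ → Fm
  | neg : Fm → Fm
  | imp : Fm → Fm → Fm
  | box : Fm → Fm
deriving DecidableEq

namespace Fm

/-- ⊤ := x₀ → x₀ -/
def top : Fm := imp (var 0) (var 0)

/-- φ ∧ ψ := ¬(φ → ¬ψ) -/
def conj (φ ψ : Fm) : Fm := neg (imp φ (neg ψ))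

/-- φ ↔ ψ := (φ → ψ) ∧ (ψ → φ) -/
def biimp (φ ψ : Fm) : Fm := conj (imp φ ψ) (imp ψ φ)

/-- strict equivalence: φ ≡ ψ := □(φ → ψ) ∧ □(ψ → φ) -/
def equiv (φ ψ : Fm) : Fm := conj (box (imp φ ψ)) (box (imp ψ φ))

/-- φ[x := ψ]: substitution of ψ for all occurrences of the variable x in φ. -/
def subst (φ : Fm) (x : ℕ) (ψ : Fm) : Fm :=
  match φ with
  | var y => if y = x then ψ else var y
  | neg χ => neg (subst χ x ψ)
  | imp χ δ => imp (subst χ x ψ) (subst δ x ψ)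
  | box χ => box (subst χ x ψ)

/-- Propositional (two-valued) evaluation of a modal formula, treating
variables and boxed formulas as atoms. -/
def pEval (v : Fm → Bool) : Fm → Bool
  | var n => v (var n)
  | neg φ => !(pEval v φ)
  | imp φ ψ => !(pEval v φ) || pEval v ψ
  | box φ => v (box φ)

/-- φ has the form of a propositional tautology, i.e. φ is a substitution
instance of a propositional tautology. -/
def isTautInstance (φ : Fm) : Prop := ∀ v : Fm → Bool, pEval v φ = true

/-- The axioms (i)–(iii) of Lewis system S1 (Lemmon-style). -/
inductive S1Axiom : Fm → Prop
  | taut {φ} : isTautInstance φ → S1Axiom φ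
  | ax2 (φ) : S1Axiom (imp (box φ) φ)
  | ax3 (φ ψ χ) :
      S1Axiom (imp (conj (box (imp φ ψ)) (box (imp ψ χ))) (box (imp φ χ)))

/-- The identity axioms (iv)–(vi), i.e. the Substitution Principle SP. -/
inductive SPAxiom : Fm → Prop
  | ax4 (φ ψ) : SPAxiom (imp (equiv φ ψ) (equiv (neg φ) (neg ψ)))
  | ax5 (φ ψ φ' ψ') :
      SPAxiom (imp (conj (equiv φ ψ) (equiv φ' ψ'))
        (equiv (imp φ φ') (imp ψ ψ')))
  | ax6 (φ ψ) : SPAxiom (imp (equiv φ ψ) (equiv (box φ) (box ψ)))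

/-- Derivability in S1+SP from a set Φ of premises: axioms (i)–(vi),
modus ponens, and Axiom Necessitation AN restricted to axioms (i)–(iii). -/
inductive S1SP : Set Fm → Fm → Prop
  | prem {Φ φ} : φ ∈ Φ → S1SP Φ φ
  | axm {Φ φ} : S1Axiom φ → S1SP Φ φ
  | spAxm {Φ φ} : SPAxiom φ → S1SP Φ φ
  | mp {Φ φ ψ} : S1SP Φ (imp φ ψ) → S1SP Φ φ → S1SP Φ ψ
  | an {Φ φ} : S1Axiom φ → S1SP Φ (box φ)

end Fm

namespace Fm

/-- Φ is consistent if some formula is not derivable from Φ in S1+SP. -/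
def Consistent (Φ : Set Fm) : Prop := ∃ φ : Fm, ¬ S1SP Φ φ

/-- Φ is maximal consistent if it is consistent and every proper extension is
inconsistent. -/
def MaxConsistent (Φ : Set Fm) : Prop :=
  Consistent Φ ∧ ∀ Ψ : Set Fm, Φ ⊂ Ψ → ¬ Consistent Ψ

end Fm

/-- An algebraic model: a Boolean algebra (with complement `ᶜ` and
implication `⇨`), a set TRUE of true propositions, and a unary operation f□,
satisfying the model conditions (1)–(6). -/
structure MModel where
  M : Type
  [ba : BooleanAlgebra M]
  TRUE : Set M
  fbox : M → M
  bot_not_true : ⊥ ∉ TRUE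
  top_true : ⊤ ∈ TRUE
  compl_true : ∀ m : M, mᶜ ∈ TRUE ↔ m ∉ TRUE
  himp_true : ∀ m m' : M, (m ⇨ m') ∈ TRUE ↔ (m ∉ TRUE ∨ m' ∈ TRUE)
  fbox_true : ∀ m : M, fbox m ∈ TRUE ↔ m = ⊤
  fbox_le : ∀ m : M, fbox m ≤ m
  fbox_trans : ∀ m m' m'' : M,
    fbox (m ⇨ m') ⊓ fbox (m' ⇨ m'') ≤ fbox (m ⇨ m'')

attribute [instance] MModel.ba

namespace MModel

/-- The canonical homomorphic extension of an assignment γ of propositions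
to the variables. -/
def eval (𝓜 : MModel) (γ : ℕ → 𝓜.M) : Fm → 𝓜.M
  | .var n => γ n
  | .neg φ => (𝓜.eval γ φ)ᶜ
  | .imp φ ψ => 𝓜.eval γ φ ⇨ 𝓜.eval γ ψ
  | .box φ => 𝓜.fbox (𝓜.eval γ φ)

/-- Satisfaction: (𝓜, γ) ⊨ φ iff γ(φ) ∈ TRUE. -/
def sat (𝓜 : MModel) (γ : ℕ → 𝓜.M) (φ : Fm) : Prop := 𝓜.eval γ φ ∈ 𝓜.TRUE

end MModel

namespace Fm

theorem S1SP.ded {Φ Ψ : Set Fm} {α φ : Fm} (hΨ : Ψ = insert α Φ) (h : S1SP Ψ φ) :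
    S1SP Φ (imp α φ) := by
  have k : ∀ φ, S1SP Φ φ → S1SP Φ (imp α φ) := fun φ hφ =>
    S1SP.mp (S1SP.axm (S1Axiom.taut (fun v => by simp only [pEval]; grind))) hφ
  induction h with
  | @prem φ hm =>
    subst hΨ
    rcases hm with rfl | hm
    · exact S1SP.axm (S1Axiom.taut (fun v => by simp only [pEval]; grind))
    · exact k _ (.prem hm)
  | axm h => exact k _ (.axm h)
  | spAxm h => exact k _ (.spAxm h)
  | an h => exact k _ (.an h)
  | @mp φ ψ _ _ ih1 ih2 =>
    have t : S1SP Φ (imp (imp α (imp φ ψ)) (imp (imp α φ) (imp α ψ))) :=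
      S1SP.axm (S1Axiom.taut (fun v => by simp only [pEval]; grind))
    exact S1SP.mp (S1SP.mp t ih1) ih2

section MC
variable {Φ : Set Fm} (h : MaxConsistent Φ)
include h

theorem mc_incons {φ : Fm} (hφ : φ ∉ Φ) (ψ : Fm) : S1SP Φ (imp φ ψ) := by
  have := h.2 (insert φ Φ) (Set.ssubset_insert hφ)
  simp only [Consistent, not_exists, not_not] at this
  exact S1SP.ded rfl (this ψ)

theorem mc_closed {φ : Fm} (hφ : S1SP Φ φ) : φ ∈ Φ := by
  by_contra hn
  obtain ⟨ψ, hψ⟩ := h.1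
  exact hψ ((mc_incons h hn ψ).mp hφ)

theorem mc_mp {φ ψ : Fm} (h1 : imp φ ψ ∈ Φ) (h2 : φ ∈ Φ) : ψ ∈ Φ :=
  mc_closed h (.mp (.prem h1) (.prem h2))

theorem mc_taut {φ : Fm} (t : isTautInstance φ) : φ ∈ Φ := mc_closed h (.axm (.taut t))

theorem mc_neg (φ : Fm) : neg φ ∈ Φ ↔ φ ∉ Φ := by
  constructor
  · intro h1 h2
    obtain ⟨ψ, hψ⟩ := h.1
    have t : imp (neg φ) (imp φ ψ) ∈ Φ :=
      mc_taut h (fun v => by simp only [pEval]; grind)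
    exact hψ (.prem (mc_mp h (mc_mp h t h1) h2))
  · intro h1
    have t : imp (imp φ (neg φ)) (neg φ) ∈ Φ :=
      mc_taut h (fun v => by simp only [pEval]; grind)
    exact mc_mp h t (mc_closed h (mc_incons h h1 _))

theorem mc_imp (φ ψ : Fm) : imp φ ψ ∈ Φ ↔ (φ ∉ Φ ∨ ψ ∈ Φ) := by
  constructor
  · intro h1
    by_cases h2 : φ ∈ Φ
    · exact .inr (mc_mp h h1 h2)
    · exact .inl h2
  · rintro (h1 | h1)
    · exact mc_closed h (mc_incons h h1 _)
    · have t : imp ψ (imp φ ψ) ∈ Φ :=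
        mc_taut h (fun v => by simp only [pEval]; grind)
      exact mc_mp h t h1

theorem mc_conj (φ ψ : Fm) : conj φ ψ ∈ Φ ↔ (φ ∈ Φ ∧ ψ ∈ Φ) := by
  simp only [conj, mc_neg h, mc_imp h]; tauto

theorem mc_equiv (φ ψ : Fm) :
    equiv φ ψ ∈ Φ ↔ (box (imp φ ψ) ∈ Φ ∧ box (imp ψ φ) ∈ Φ) := mc_conj h _ _

theorem nc_taut {φ : Fm} (t : isTautInstance φ) : box φ ∈ Φ := mc_closed h (.an (.taut t))

theorem nc_trans {φ ψ χ : Fm} (h1 : box (imp φ ψ) ∈ Φ) (h2 : box (imp ψ χ) ∈ Φ) :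
    box (imp φ χ) ∈ Φ :=
  mc_mp h (mc_closed h (.axm (.ax3 φ ψ χ))) ((mc_conj h _ _).2 ⟨h1, h2⟩)

theorem nc_top (φ : Fm) : box (imp top φ) ∈ Φ ↔ box φ ∈ Φ := by
  have e : equiv φ (imp top φ) ∈ Φ := (mc_equiv h _ _).2
    ⟨nc_taut h (fun v => by simp only [pEval, top]; grind),
     nc_taut h (fun v => by simp only [pEval, top]; grind)⟩
  have e2 := (mc_equiv h _ _).1 (mc_mp h (mc_closed h (.spAxm (.ax6 _ _))) e)
  exact ⟨fun h1 => mc_mp h (mc_mp h (mc_closed h (.axm (.ax2 _))) e2.2) h1,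
    fun h1 => mc_mp h (mc_mp h (mc_closed h (.axm (.ax2 _))) e2.1) h1⟩

theorem nc_mp {φ ψ : Fm} (h1 : box (imp φ ψ) ∈ Φ) (h2 : box φ ∈ Φ) : box ψ ∈ Φ :=
  (nc_top h _).1 (nc_trans h ((nc_top h _).2 h2) h1)

theorem nc_t1 {a b : Fm} (h1 : box a ∈ Φ) (t : isTautInstance (imp a b)) : box b ∈ Φ :=
  nc_mp h (nc_taut h t) h1

theorem nc_t2 {a b c : Fm} (h1 : box a ∈ Φ) (h2 : box b ∈ Φ)
    (t : isTautInstance (imp a (imp b c))) : box c ∈ Φ :=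
  nc_mp h (nc_mp h (nc_taut h t) h1) h2

theorem nc_t4 {a b c d e : Fm} (h1 : box a ∈ Φ) (h2 : box b ∈ Φ) (h3 : box c ∈ Φ)
    (h4 : box d ∈ Φ)
    (t : isTautInstance (imp a (imp b (imp c (imp d e))))) : box e ∈ Φ :=
  nc_mp h (nc_mp h (nc_t2 h h1 h2 t) h3) h4

end MC

/-- Strict equivalence modulo a maximal consistent set. -/
def lset {Φ : Set Fm} (h : MaxConsistent Φ) : Setoid Fm where
  r a b := box (imp a b) ∈ Φ ∧ box (imp b a) ∈ Φ
  iseqv := ⟨fun a => ⟨nc_taut h (fun v => by simp only [pEval]; grind),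
      nc_taut h (fun v => by simp only [pEval]; grind)⟩,
    fun h1 => ⟨h1.2, h1.1⟩,
    fun h1 h2 => ⟨nc_trans h h1.1 h2.1, nc_trans h h2.2 h1.2⟩⟩

/-- The Lindenbaum algebra carrier. -/
def LQ {Φ : Set Fm} (h : MaxConsistent Φ) : Type := Quotient (lset h)

section LQ
variable {Φ : Set Fm} (h : MaxConsistent Φ)

/-- Class of a formula. -/
def lmk (a : Fm) : LQ h := Quotient.mk (lset h) a

theorem lmk_eq {a b : Fm} : lmk h a = lmk h b ↔ (box (imp a b) ∈ Φ ∧ box (imp b a) ∈ Φ) :=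
  Quotient.eq (r := lset h)

/-- Negation. -/
def lneg : LQ h → LQ h := Quotient.map (sa := lset h) (sb := lset h) neg fun _ _ e =>
  ⟨nc_t1 h e.2 (fun v => by simp only [pEval]; grind),
   nc_t1 h e.1 (fun v => by simp only [pEval]; grind)⟩

/-- Implication. -/
def limp : LQ h → LQ h → LQ h :=
  Quotient.map₂ (sa := lset h) (sb := lset h) (sc := lset h) imp fun _ _ e _ _ e' =>
  ⟨nc_t2 h e.2 e'.1 (fun v => by simp only [pEval]; grind),
   nc_t2 h e.1 e'.2 (fun v => by simp only [pEval]; grind)⟩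

/-- Box. -/
def lbox : LQ h → LQ h := Quotient.map (sa := lset h) (sb := lset h) box fun a b e =>
  (mc_equiv h _ _).1 (mc_mp h (mc_closed h (.spAxm (.ax6 a b))) ((mc_equiv h _ _).2 e))

/-- Truth. -/
def ltrue : LQ h → Prop := Quotient.lift (s := lset h) (fun a => a ∈ Φ) fun a b e =>
  propext ⟨mc_mp h (mc_mp h (mc_closed h (.axm (.ax2 _))) e.1),
    mc_mp h (mc_mp h (mc_closed h (.axm (.ax2 _))) e.2)⟩

theorem lind {p : LQ h → Prop} (H : ∀ a, p (lmk h a)) (x : LQ h) : p x :=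
  Quotient.ind (s := lset h) H x

/-- Order. -/
def lle (x y : LQ h) : Prop := limp h x y = lmk h top

theorem lle_iff (a b : Fm) : lle h (lmk h a) (lmk h b) ↔ box (imp a b) ∈ Φ := by
  change lmk h (imp a b) = lmk h top ↔ _
  rw [lmk_eq, nc_top h]
  exact ⟨fun e => e.2, fun e => ⟨nc_taut h (fun v => by simp only [pEval, top]; grind), e⟩⟩

/-- The Lindenbaum Boolean algebra. -/
def lba : BooleanAlgebra (LQ h) where
  le := lle h
  le_refl := lind h fun a => (lle_iff h _ _).2 (nc_taut h (fun v => by simp only [pEval]; grind))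
  le_trans := lind h fun a => lind h fun b => lind h fun c h1 h2 => by
    rw [lle_iff] at *
    exact nc_trans h h1 h2
  le_antisymm := lind h fun a => lind h fun b h1 h2 =>
    (lmk_eq h).2 ⟨(lle_iff h _ _).1 h1, (lle_iff h _ _).1 h2⟩
  sup x y := limp h (lneg h x) y
  inf x y := lneg h (limp h x (lneg h y))
  le_sup_left := lind h fun a => lind h fun b =>
    (lle_iff h a (imp (neg a) b)).2 (nc_taut h (fun v => by simp only [pEval]; grind))
  le_sup_right := lind h fun a => lind h fun b =>
    (lle_iff h b (imp (neg a) b)).2 (nc_taut h (fun v => by simp only [pEval]; grind))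
  sup_le := lind h fun a => lind h fun b => lind h fun c h1 h2 =>
    (lle_iff h (imp (neg a) b) c).2 (nc_t2 h ((lle_iff h _ _).1 h1) ((lle_iff h _ _).1 h2)
      (fun v => by simp only [pEval]; grind))
  inf_le_left := lind h fun a => lind h fun b =>
    (lle_iff h (conj a b) a).2 (nc_taut h (fun v => by simp only [pEval, conj]; grind))
  inf_le_right := lind h fun a => lind h fun b =>
    (lle_iff h (conj a b) b).2 (nc_taut h (fun v => by simp only [pEval, conj]; grind))
  le_inf := lind h fun a => lind h fun b => lind h fun c h1 h2 =>
    (lle_iff h a (conj b c)).2 (nc_t2 h ((lle_iff h _ _).1 h1) ((lle_iff h _ _).1 h2)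
      (fun v => by simp only [pEval, conj]; grind))
  le_sup_inf := lind h fun a => lind h fun b => lind h fun c =>
    (lle_iff h (conj (imp (neg a) b) (imp (neg a) c)) (imp (neg a) (conj b c))).2
      (nc_taut h (fun v => by simp only [pEval, conj]; grind))
  compl := lneg h
  himp := limp h
  top := lmk h top
  bot := lneg h (lmk h top)
  inf_compl_le_bot := lind h fun a => (lle_iff h (conj a (neg a)) (neg top)).2
    (nc_taut h (fun v => by simp only [pEval, conj, top]; grind))
  top_le_sup_compl := lind h fun a => (lle_iff h top (imp (neg a) (neg a))).2
    (nc_taut h (fun v => by simp only [pEval, top]; grind))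
  le_top := lind h fun a => (lle_iff h a top).2
    (nc_taut h (fun v => by simp only [pEval, top]; grind))
  bot_le := lind h fun a => (lle_iff h (neg top) a).2
    (nc_taut h (fun v => by simp only [pEval, top]; grind))
  himp_eq := lind h fun a => lind h fun b => (lmk_eq h (a := imp a b) (b := imp (neg b) (neg a))).2
    ⟨nc_taut h (fun v => by simp only [pEval]; grind),
     nc_taut h (fun v => by simp only [pEval]; grind)⟩

/-- The canonical model. -/
def lmodel : MModel :=
  letI := lba h
  { M := LQ h
    TRUE := {x | ltrue h x}
    fbox := lbox h
    bot_not_true := fun e => (mc_neg h top).1 e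
      (mc_taut h (fun v => by simp only [pEval, top]; grind))
    top_true := mc_taut h (fun v => by simp only [pEval, top]; grind)
    compl_true := lind h fun a => mc_neg h a
    himp_true := lind h fun a => lind h fun b => mc_imp h a b
    fbox_true := lind h fun a => by
      refine Iff.trans (b := box a ∈ Φ) Iff.rfl (Iff.trans ?_ (lmk_eq h (a := a) (b := top)).symm)
      rw [nc_top h]
      exact ⟨fun e => ⟨nc_taut h (fun v => by simp only [pEval, top]; grind), e⟩, fun e => e.2⟩
    fbox_le := lind h fun a => (lle_iff h (box a) a).2 (mc_closed h (.an (.ax2 a)))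
    fbox_trans := lind h fun a => lind h fun b => lind h fun c =>
      (lle_iff h (conj (box (imp a b)) (box (imp b c))) (box (imp a c))).2
        (mc_closed h (.an (.ax3 a b c))) }

theorem lmodel_eval (φ : Fm) : (lmodel h).eval (fun n => lmk h (var n)) φ = lmk h φ := by
  induction φ with
  | var n => rfl
  | neg a ih => exact congrArg (lneg h) ih
  | imp a b iha ihb => exact congrArg₂ (limp h) iha ihb
  | box a ih => exact congrArg (lbox h) ih

end LQ
end Fm

open Fm in
/-- Model existence: every maximal consistent set has a model. -/
theorem model_existence (Φ : Set Fm) (h : MaxConsistent Φ) :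
    ∃ (𝓜 : MModel) (γ : ℕ → 𝓜.M), ∀ φ ∈ Φ, 𝓜.sat γ φ := by
  refine ⟨lmodel h, fun n => lmk h (var n), fun φ hφ => ?_⟩
  unfold MModel.sat
  rw [lmodel_eval]
  exact hφ
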